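/- arXiv:2502.11979 — 2 statements merged into one kernel-verified Lean document; each statement's English description precedes it below -/
import Mathlib

section
/- Let G = (V, E) be a finite undirected graph and B a nonempty finite multiset of drivers such that every driver (u, v, b) ∈ B has u ≠ v and u, v in the same connected component of G. For p ≥ 0 let URev(p) denote the revenue of the uniform pricing with price p. Then there exists a driver (u', v', b') ∈ B such that for all p ≥ 0, URev(b'/hop(u', v')) ≥ URev(p); i.e., the optimal single price belongs to the set { b/hop(u, v) : (u, v, b) ∈ B }. -/
open scoped ENNReal

namespace Toll

/-- The total price (weight) of a walk: sum of prices of its edges. -/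
noncomputable def walkWeight {V : Type*} (G : SimpleGraph V) (p : Sym2 V → NNReal)
    {u v : V} (wk : G.Walk u v) : NNReal :=
  (wk.edges.map p).sum

/-- The distance between `u` and `v` under pricing `p`: the minimum total price of
a `u`–`v` path (`∞` if there is none). -/
noncomputable def gdist {V : Type*} (G : SimpleGraph V) (p : Sym2 V → NNReal)
    (u v : V) : ℝ≥0∞ :=
  ⨅ wk : G.Walk u v, (walkWeight G p wk : ℝ≥0∞)

/-- The revenue of pricing `p` with respect to the driver multiset `B`. -/
noncomputable def rev {V : Type*} (G : SimpleGraph V) (B : Multiset (V × V × NNReal))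
    (p : Sym2 V → NNReal) : ℝ≥0∞ :=
  (B.map fun d =>
    if gdist G p d.1 d.2.1 ≤ (d.2.2 : ℝ≥0∞) then gdist G p d.1 d.2.1 else 0).sum

/-- The optimal revenue: supremum of the revenue over all pricings. -/
noncomputable def OPT {V : Type*} (G : SimpleGraph V) (B : Multiset (V × V × NNReal)) : ℝ≥0∞ :=
  ⨆ p : Sym2 V → NNReal, rev G B p

/-- The maximum budget of a driver in `B`. -/
noncomputable def bmax {V : Type*} (B : Multiset (V × V × NNReal)) : NNReal :=
  (B.map fun d => d.2.2).sup

end Toll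

namespace Toll

theorem walkWeight_const {V : Type*} (G : SimpleGraph V) (p : NNReal) {u v : V}
    (wk : G.Walk u v) : walkWeight G (fun _ => p) wk = wk.length * p := by
  simp [walkWeight]

theorem gdist_const {V : Type*} (G : SimpleGraph V) (p : NNReal) {u v : V}
    (h : G.Reachable u v) : gdist G (fun _ => p) u v = ((G.dist u v * p : NNReal) : ℝ≥0∞) := by
  apply le_antisymm
  · obtain ⟨wk, hwk⟩ := h.exists_walk_length_eq_dist
    exact (iInf_le _ wk).trans_eq (by rw [walkWeight_const, hwk])
  · refine le_iInf fun wk => ?_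
    rw [walkWeight_const, ENNReal.coe_le_coe]
    gcongr
    exact SimpleGraph.dist_le wk

/-- Every uniform price is dominated by one of the form `b / hop(u, v)`. -/
theorem exists_rev_const_le {V : Type*} (G : SimpleGraph V)
    (B : Multiset (V × V × NNReal)) (hB : B ≠ 0)
    (hdrivers : ∀ d ∈ B, d.1 ≠ d.2.1 ∧ G.Reachable d.1 d.2.1) (p : NNReal) :
    ∃ d ∈ B, rev G B (fun _ => p) ≤
      rev G B (fun _ => d.2.2 / (G.dist d.1 d.2.1 : NNReal)) := by
  classical
  have hpos : ∀ d ∈ B, (0 : NNReal) < G.dist d.1 d.2.1 := fun d hd =>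
    Nat.cast_pos.2 ((hdrivers d hd).2.pos_dist_of_ne (hdrivers d hd).1)
  let served := B.toFinset.filter fun d => p ≤ d.2.2 / (G.dist d.1 d.2.1 : NNReal)
  obtain hserved | hserved := served.eq_empty_or_nonempty
  · obtain ⟨d, hd⟩ := Multiset.exists_mem_of_ne_zero hB
    refine ⟨d, hd, Multiset.sum_map_le_sum_map _ _ fun e he => ?_⟩
    rw [if_neg]
    · exact zero_le
    · rw [gdist_const G p (hdrivers e he).2, ENNReal.coe_le_coe, mul_comm, ← le_div_iff₀ (hpos e he)]
      exact fun hle => Finset.notMem_empty e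
        (hserved ▸ Finset.mem_filter.2 ⟨Multiset.mem_toFinset.2 he, hle⟩)
  · obtain ⟨d, hd, hmin⟩ := served.exists_min_image
      (fun d => d.2.2 / (G.dist d.1 d.2.1 : NNReal)) hserved
    obtain ⟨hdB, hpd⟩ := Finset.mem_filter.1 hd
    refine ⟨d, Multiset.mem_toFinset.1 hdB, Multiset.sum_map_le_sum_map _ _ fun e he => ?_⟩
    simp only [gdist_const G _ (hdrivers e he).2, ENNReal.coe_le_coe]
    split_ifs with hp hq
    · exact ENNReal.coe_le_coe.2 (by gcongr)
    · rw [mul_comm, ← le_div_iff₀ (hpos e he)] at hp hq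
      exact absurd (hmin e (Finset.mem_filter.2 ⟨Multiset.mem_toFinset.2 he, hp⟩)) hq
    all_goals exact zero_le

end Toll

open Toll

/-- The optimal single (uniform) price is attained at `b/hop(u, v)` for some driver
`(u, v, b) ∈ B`. -/
theorem optimal_single_price {V : Type*} [Fintype V] [DecidableEq V]
    (G : SimpleGraph V) [DecidableRel G.Adj]
    (B : Multiset (V × V × NNReal)) (hB : B ≠ 0)
    (hdrivers : ∀ d ∈ B, d.1 ≠ d.2.1 ∧ G.Reachable d.1 d.2.1) :
    ∃ d ∈ B, ∀ p : NNReal,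
      rev G B (fun _ => p) ≤
        rev G B (fun _ => d.2.2 / (G.dist d.1 d.2.1 : NNReal)) := by
  classical
  obtain ⟨d₀, hd₀⟩ := Multiset.exists_mem_of_ne_zero hB
  obtain ⟨d, hd, hmax⟩ := B.toFinset.exists_max_image
    (fun d => rev G B (fun _ => d.2.2 / (G.dist d.1 d.2.1 : NNReal)))
    ⟨d₀, Multiset.mem_toFinset.2 hd₀⟩
  refine ⟨d, Multiset.mem_toFinset.1 hd, fun p => ?_⟩
  obtain ⟨e, he, hle⟩ := exists_rev_const_le G B hB hdrivers p
  exact hle.trans (hmax e (Multiset.mem_toFinset.2 he))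
end

section
/- Let G be a finite undirected graph that is the union of two edge-disjoint subgraphs G_A and G_B with R = V(G_A) ∩ V(G_B), and let S_A, S_B be vertex sets with R ⊆ S_A ⊆ V(G_A) and R ⊆ S_B ⊆ V(G_B). Let w and w' be two nonnegative real edge-weight functions on G such that for all a, b ∈ S_A the distances between a and b within G_A under w and under w' are equal, and for all a, b ∈ S_B the distances between a and b within G_B under w and under w' are equal. Then for all x, y ∈ S_A ∪ S_B, the distances between x and y in the whole graph G under w and under w' are equal. (In particular, the distance matrices of the two parts on sets containing the common row R determine all pairwise distances on S_A ∪ S_B in the union.) -/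
open scoped ENNReal

open Toll

namespace Toll

variable {V : Type*}

theorem gdist_le_walkWeight (G : SimpleGraph V) (p : Sym2 V → NNReal) {u v : V}
    (wk : G.Walk u v) : gdist G p u v ≤ walkWeight G p wk :=
  iInf_le _ wk

theorem gdist_self (G : SimpleGraph V) (p : Sym2 V → NNReal) (u : V) : gdist G p u u = 0 := by
  simpa [walkWeight] using gdist_le_walkWeight G p (SimpleGraph.Walk.nil : G.Walk u u)

theorem gdist_le_of_adj (G : SimpleGraph V) (p : Sym2 V → NNReal) {u v : V} (h : G.Adj u v) :
    gdist G p u v ≤ p s(u, v) := by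
  simpa [walkWeight] using gdist_le_walkWeight G p h.toWalk

theorem gdist_triangle (G : SimpleGraph V) (p : Sym2 V → NNReal) (u v t : V) :
    gdist G p u t ≤ gdist G p u v + gdist G p v t := by
  conv_rhs => unfold gdist
  refine ENNReal.le_iInf_add_iInf fun q r => ?_
  simpa [walkWeight] using gdist_le_walkWeight G p (q.append r)

theorem gdist_anti {G H : SimpleGraph V} (hGH : G ≤ H) (p : Sym2 V → NNReal) (u v : V) :
    gdist H p u v ≤ gdist G p u v := by
  refine le_iInf fun wk => ?_
  simpa [walkWeight] using gdist_le_walkWeight H p (wk.mapLe hGH)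

/-- A bound on distances to `y` through `v`, valid from either part, extends across an edge `uv` of
`GA` or `GB`: if the edge leaves `GA`, then `u` is a common vertex, so the distance in `GA` from
`x` to `u` is the same under `w` and `w'`. -/
theorem gdist_le_gdist_add_of_edge {G : SimpleGraph V} {GA GB : G.Subgraph} {SA SB : Set V}
    (hRA : GA.verts ∩ GB.verts ⊆ SA) (hRB : GA.verts ∩ GB.verts ⊆ SB) {w w' : Sym2 V → NNReal}
    (hA : ∀ a ∈ SA, ∀ b ∈ SA, gdist GA.spanningCoe w a b = gdist GA.spanningCoe w' a b)
    {u v y : V} {c : ℝ≥0∞} (hadj : GA.Adj u v ∨ GB.Adj u v)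
    (hvA : v ∈ GA.verts → ∀ x ∈ SA, gdist G w' x y ≤ gdist GA.spanningCoe w x v + c)
    (hvB : v ∈ GB.verts → ∀ x ∈ SB, gdist G w' x y ≤ gdist GB.spanningCoe w x v + c)
    (hu : u ∈ GA.verts) {x : V} (hx : x ∈ SA) :
    gdist G w' x y ≤ gdist GA.spanningCoe w x u + (w s(u, v) + c) := by
  rcases hadj with h | h
  · calc gdist G w' x y ≤ gdist GA.spanningCoe w x v + c := hvA h.snd_mem x hx
      _ ≤ gdist GA.spanningCoe w x u + gdist GA.spanningCoe w u v + c := by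
        gcongr; exact gdist_triangle _ _ _ _ _
      _ ≤ gdist GA.spanningCoe w x u + w s(u, v) + c := by
        gcongr; exact gdist_le_of_adj _ _ h
      _ = _ := add_assoc _ _ _
  · have huR : u ∈ GA.verts ∩ GB.verts := ⟨hu, h.fst_mem⟩
    calc gdist G w' x y ≤ gdist G w' x u + gdist G w' u y := gdist_triangle _ _ _ _ _
      _ ≤ gdist GA.spanningCoe w' x u + (gdist GB.spanningCoe w u v + c) := by
        gcongr
        · exact gdist_anti GA.spanningCoe_le _ _ _
        · exact hvB h.snd_mem u (hRB huR)
      _ ≤ gdist GA.spanningCoe w x u + (w s(u, v) + c) := by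
        rw [hA x hx u (hRA huR)]
        gcongr
        exact gdist_le_of_adj _ _ h

theorem gdist_le_gdist_add_walkWeight {G : SimpleGraph V} {GA GB : G.Subgraph} {SA SB : Set V}
    (hunion : GA ⊔ GB = ⊤)
    (hRA : GA.verts ∩ GB.verts ⊆ SA) (hSA : SA ⊆ GA.verts)
    (hRB : GA.verts ∩ GB.verts ⊆ SB) (hSB : SB ⊆ GB.verts) {w w' : Sym2 V → NNReal}
    (hA : ∀ a ∈ SA, ∀ b ∈ SA, gdist GA.spanningCoe w a b = gdist GA.spanningCoe w' a b)
    (hB : ∀ a ∈ SB, ∀ b ∈ SB, gdist GB.spanningCoe w a b = gdist GB.spanningCoe w' a b)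
    {u y : V} (wk : G.Walk u y) (hy : y ∈ SA ∪ SB) :
    (u ∈ GA.verts → ∀ x ∈ SA,
      gdist G w' x y ≤ gdist GA.spanningCoe w x u + walkWeight G w wk) ∧
    (u ∈ GB.verts → ∀ x ∈ SB,
      gdist G w' x y ≤ gdist GB.spanningCoe w x u + walkWeight G w wk) := by
  induction wk with
  | @nil y =>
    refine ⟨fun hu x hx => ?_, fun hu x hx => ?_⟩
    · have hyA : y ∈ SA := hy.elim id fun h => hRA ⟨hu, hSB h⟩
      simpa [walkWeight, hA x hx y hyA] using gdist_anti GA.spanningCoe_le w' x y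
    · have hyB : y ∈ SB := hy.elim (fun h => hRB ⟨hSA h, hu⟩) id
      simpa [walkWeight, hB x hx y hyB] using gdist_anti GB.spanningCoe_le w' x y
  | @cons u v y h q ih =>
    obtain ⟨ihA, ihB⟩ := ih hy
    have hadj : GA.Adj u v ∨ GB.Adj u v := by
      rw [← SimpleGraph.Subgraph.sup_adj, hunion]
      exact h
    have hweight : (walkWeight G w (.cons h q) : ℝ≥0∞) = w s(u, v) + walkWeight G w q := by
      simp [walkWeight]
    rw [hweight]
    refine ⟨fun hu x hx => gdist_le_gdist_add_of_edge hRA hRB hA hadj ihA ihB hu hx,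
      fun hu x hx => gdist_le_gdist_add_of_edge ?_ ?_ hB hadj.symm ihB ihA hu hx⟩
    · rwa [Set.inter_comm]
    · rwa [Set.inter_comm]

theorem gdist_le_gdist_of_parts {G : SimpleGraph V} {GA GB : G.Subgraph} {SA SB : Set V}
    (hunion : GA ⊔ GB = ⊤)
    (hRA : GA.verts ∩ GB.verts ⊆ SA) (hSA : SA ⊆ GA.verts)
    (hRB : GA.verts ∩ GB.verts ⊆ SB) (hSB : SB ⊆ GB.verts) {w w' : Sym2 V → NNReal}
    (hA : ∀ a ∈ SA, ∀ b ∈ SA, gdist GA.spanningCoe w a b = gdist GA.spanningCoe w' a b)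
    (hB : ∀ a ∈ SB, ∀ b ∈ SB, gdist GB.spanningCoe w a b = gdist GB.spanningCoe w' a b)
    {x y : V} (hx : x ∈ SA ∪ SB) (hy : y ∈ SA ∪ SB) : gdist G w' x y ≤ gdist G w x y := by
  refine le_iInf fun wk => ?_
  obtain ⟨h₁, h₂⟩ := gdist_le_gdist_add_walkWeight hunion hRA hSA hRB hSB hA hB wk hy
  rcases hx with hx | hx
  · simpa [gdist_self] using h₁ (hSA hx) x hx
  · simpa [gdist_self] using h₂ (hSB hx) x hx

end Toll

/-- **Distance-matrix product.** If `G` is the union of two edge-disjoint subgraphs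
`GA`, `GB` with common vertex set `R = GA.verts ∩ GB.verts`, `R ⊆ SA ⊆ GA.verts`,
`R ⊆ SB ⊆ GB.verts`, and two weightings `w`, `w'` induce the same pairwise distances on
`SA` within `GA` and on `SB` within `GB`, then they induce the same pairwise distances on
`SA ∪ SB` in the whole graph `G`.  (Distances within a subgraph are taken through its
spanning coercion, i.e. using only its edges, and are `+∞` if no path exists.) -/
theorem distance_matrix_product {V : Type*} [Fintype V] [DecidableEq V]
    (G : SimpleGraph V) (GA GB : G.Subgraph)
    (hunion : GA ⊔ GB = ⊤)
    (hdisj : GA.edgeSet ∩ GB.edgeSet = ∅)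
    (SA SB : Set V)
    (hRA : GA.verts ∩ GB.verts ⊆ SA) (hSA : SA ⊆ GA.verts)
    (hRB : GA.verts ∩ GB.verts ⊆ SB) (hSB : SB ⊆ GB.verts)
    (w w' : Sym2 V → NNReal)
    (hA : ∀ a ∈ SA, ∀ b ∈ SA,
      gdist GA.spanningCoe w a b = gdist GA.spanningCoe w' a b)
    (hB : ∀ a ∈ SB, ∀ b ∈ SB,
      gdist GB.spanningCoe w a b = gdist GB.spanningCoe w' a b) :
    ∀ x ∈ SA ∪ SB, ∀ y ∈ SA ∪ SB, gdist G w x y = gdist G w' x y := by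
  intro x hx y hy
  exact le_antisymm
    (gdist_le_gdist_of_parts hunion hRA hSA hRB hSB (fun a ha b hb => (hA a ha b hb).symm)
      (fun a ha b hb => (hB a ha b hb).symm) hx hy)
    (gdist_le_gdist_of_parts hunion hRA hSA hRB hSB hA hB hx hy)
end
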